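/- If 𝓑 is an upper normal crystal and 𝓑' is a normal crystal, then the product 𝓑 × 𝓑' is an upper normal crystal; dually, if 𝓑 is lower normal and 𝓑' is normal, then 𝓑' × 𝓑 is lower normal. In particular, for all (b, b') ∈ B × B' and i ∈ I, the quantity ℓᵢ(b, b') = sup{n ≥ 0 : ẽᵢⁿ(b, b') is defined} is finite and equals ε''ᵢ(b, b') = max(ε'ᵢ(b'), εᵢ(b) − αᵢ(γ'(b'))). -/

import Mathlib

/-- The data of a crystal: a set `B` with a weight map `wt : B → Λ`, functions
`φ ε : I → B → ℤ`, and for each `i ∈ I` a family of partial maps `e i n : B → Option B`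
(modelling the `n`-th powers `ẽᵢⁿ` of the partial bijection `ẽᵢ`). -/
structure PreCrystal (I : Type*) (Λ : Type*) [AddCommGroup Λ] where
  B : Type*
  wt : B → Λ
  φ : I → B → ℤ
  ε : I → B → ℤ
  e : I → ℤ → B → Option B

variable {I : Type*} {Λ : Type*} [AddCommGroup Λ]

/-- The crystal axioms: `φᵢ(b) − εᵢ(b) = αᵢ(γ(b))`; the partial maps `e i n` are the
`n`-th powers of a partial bijection, i.e. `e i 0 = id`, they compose, are mutually
inverse, and are defined on intervals of exponents; and whenever `ẽᵢⁿ(b)` is defined one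
has `γ(ẽᵢⁿ(b)) = γ(b) + n·αᵢ^∨` and `εᵢ(ẽᵢⁿ(b)) = εᵢ(b) − n`. -/
def IsCrystal (αv : I → Λ) (pairing : I → Λ →+ ℤ) (C : PreCrystal I Λ) : Prop :=
  (∀ i b, C.φ i b - C.ε i b = pairing i (C.wt b)) ∧
  (∀ i b, C.e i 0 b = some b) ∧
  (∀ i (m n : ℤ) b c d, C.e i n b = some c → C.e i m c = some d →
    C.e i (m + n) b = some d) ∧
  (∀ i (n : ℤ) b c, C.e i n b = some c → C.e i (-n) c = some b) ∧
  (∀ i (n m : ℤ) b, (C.e i n b).isSome → min 0 n ≤ m → m ≤ max 0 n →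
    (C.e i m b).isSome) ∧
  (∀ i (n : ℤ) b c, C.e i n b = some c → C.wt c = C.wt b + n • αv i) ∧
  (∀ i (n : ℤ) b c, C.e i n b = some c → C.ε i c = C.ε i b - n)

/-- A crystal is upper normal if for all `i, b` the quantity
`ℓᵢ(b) = sup{n ≥ 0 : ẽᵢⁿ(b) is defined}` is finite and equals `εᵢ(b)`:
`ẽᵢ^{εᵢ(b)}(b)` is defined and no `ẽᵢⁿ(b)` with `n > εᵢ(b)` is defined. -/
def UpperNormal (C : PreCrystal I Λ) : Prop :=
  ∀ i b, (C.e i (C.ε i b) b).isSome ∧ ∀ n : ℤ, (C.e i n b).isSome → n ≤ C.ε i b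

/-- A crystal is lower normal if for all `i, b` the quantity
`ℓ₋ᵢ(b) = sup{n ≥ 0 : ẽᵢ⁻ⁿ(b) is defined}` is finite and equals `φᵢ(b)`. -/
def LowerNormal (C : PreCrystal I Λ) : Prop :=
  ∀ i b, (C.e i (-(C.φ i b)) b).isSome ∧ ∀ n : ℤ, (C.e i n b).isSome → -(C.φ i b) ≤ n

/-- A crystal is normal if it is both upper and lower normal. -/
def NormalCrystal (C : PreCrystal I Λ) : Prop := UpperNormal C ∧ LowerNormal C

/-- The product of two crystals: underlying set `B × B'`,
`γ''(b,b') = γ(b) + γ'(b')`, `φ''ᵢ(b,b') = max(φᵢ(b), φ'ᵢ(b') + αᵢ(γ(b)))`,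
`ε''ᵢ(b,b') = max(ε'ᵢ(b'), εᵢ(b) − αᵢ(γ'(b')))`, and
`ẽᵢⁿ(b,b') = (ẽᵢ^{n₁}(b), ẽᵢ^{n₂}(b'))` (defined iff both components are defined), with
`n₁ = max(εᵢ(b), φ'ᵢ(b')) − max(εᵢ(b) − n, φ'ᵢ(b'))` and
`n₂ = max(εᵢ(b), φ'ᵢ(b') + n) − max(εᵢ(b), φ'ᵢ(b'))`. -/
def PreCrystal.prod (pairing : I → Λ →+ ℤ) (C C' : PreCrystal I Λ) : PreCrystal I Λ where
  B := C.B × C'.B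
  wt := fun p => C.wt p.1 + C'.wt p.2
  φ := fun i p => max (C.φ i p.1) (C'.φ i p.2 + pairing i (C.wt p.1))
  ε := fun i p => max (C'.ε i p.2) (C.ε i p.1 - pairing i (C'.wt p.2))
  e := fun i n p =>
    (C.e i (max (C.ε i p.1) (C'.φ i p.2) - max (C.ε i p.1 - n) (C'.φ i p.2)) p.1).bind
      fun b =>
        (C'.e i (max (C.ε i p.1) (C'.φ i p.2 + n) - max (C.ε i p.1) (C'.φ i p.2))
            p.2).map
          fun b' => (b, b')

theorem PreCrystal.prod_e_eq_some_iff (pairing : I → Λ →+ ℤ) (C C' : PreCrystal I Λ)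
    (i : I) (n : ℤ) (p q : C.B × C'.B) :
    (C.prod pairing C').e i n p = some q ↔
      C.e i (max (C.ε i p.1) (C'.φ i p.2) - max (C.ε i p.1 - n) (C'.φ i p.2)) p.1 = some q.1 ∧
      C'.e i (max (C.ε i p.1) (C'.φ i p.2 + n) - max (C.ε i p.1) (C'.φ i p.2)) p.2 =
        some q.2 := by
  obtain ⟨q, q'⟩ := q
  simp only [PreCrystal.prod, Option.bind_eq_some_iff, Option.map_eq_some_iff, Prod.mk.injEq]
  grind

theorem PreCrystal.isSome_prod_e_iff (pairing : I → Λ →+ ℤ) (C C' : PreCrystal I Λ)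
    (i : I) (n : ℤ) (p : C.B × C'.B) :
    ((C.prod pairing C').e i n p).isSome ↔
      (C.e i (max (C.ε i p.1) (C'.φ i p.2) - max (C.ε i p.1 - n) (C'.φ i p.2)) p.1).isSome ∧
      (C'.e i (max (C.ε i p.1) (C'.φ i p.2 + n) - max (C.ε i p.1) (C'.φ i p.2)) p.2).isSome := by
  simp only [Option.isSome_iff_exists]
  constructor
  · rintro ⟨q, hq⟩
    obtain ⟨h, h'⟩ := (PreCrystal.prod_e_eq_some_iff pairing C C' i n p q).1 hq
    exact ⟨⟨_, h⟩, ⟨_, h'⟩⟩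
  · rintro ⟨⟨c, h⟩, ⟨c', h'⟩⟩
    exact ⟨(c, c'), (PreCrystal.prod_e_eq_some_iff pairing C C' i n p (c, c')).2 ⟨h, h'⟩⟩

theorem IsCrystal.φ_of_e_eq_some {αv : I → Λ} {pairing : I → Λ →+ ℤ}
    (hpair : ∀ i, pairing i (αv i) = 2) {C : PreCrystal I Λ} (hC : IsCrystal αv pairing C)
    {i : I} {n : ℤ} {b c : C.B} (h : C.e i n b = some c) : C.φ i c = C.φ i b + n := by
  obtain ⟨hwt, -, -, -, -, hγ, hε⟩ := hC
  have h₁ := hwt i b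
  have h₂ := hwt i c
  rw [hγ i n b c h, map_add, map_zsmul, hpair, smul_eq_mul] at h₂
  have h₃ := hε i n b c h
  linarith

/-- The product of two crystals is a crystal. -/
theorem IsCrystal.prod {αv : I → Λ} {pairing : I → Λ →+ ℤ}
    (hpair : ∀ i, pairing i (αv i) = 2) {C C' : PreCrystal I Λ}
    (hC : IsCrystal αv pairing C) (hC' : IsCrystal αv pairing C') :
    IsCrystal αv pairing (C.prod pairing C') := by
  have hφ' {i : I} {n : ℤ} {b c : C'.B} (h : C'.e i n b = some c) :
      C'.φ i c = C'.φ i b + n := hC'.φ_of_e_eq_some hpair h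
  obtain ⟨hwt, hzero, hcomp, hinv, hint, hγ, hε⟩ := hC
  obtain ⟨hwt', hzero', hcomp', hinv', hint', hγ', hε'⟩ := hC'
  refine ⟨?_, ?_, ?_, ?_, ?_, ?_, ?_⟩
  · rintro i ⟨b, b'⟩
    have h₁ := hwt i b
    have h₂ := hwt' i b'
    simp only [PreCrystal.prod, map_add]
    omega
  · rintro i ⟨b, b'⟩
    refine (PreCrystal.prod_e_eq_some_iff pairing C C' i 0 _ _).2 ?_
    simp [hzero, hzero']
  · rintro i m n ⟨b, b'⟩ ⟨c, c'⟩ ⟨d, d'⟩ hbc hcd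
    obtain ⟨h, h'⟩ := (PreCrystal.prod_e_eq_some_iff pairing C C' i n _ _).1 hbc
    obtain ⟨k, k'⟩ := (PreCrystal.prod_e_eq_some_iff pairing C C' i m _ _).1 hcd
    refine (PreCrystal.prod_e_eq_some_iff pairing C C' i (m + n) _ _).2 ?_
    have hεc := hε _ _ _ _ h
    have hφc := hφ' h'
    dsimp only at *
    constructor
    · convert hcomp i _ _ _ _ _ h k using 2
      omega
    · convert hcomp' i _ _ _ _ _ h' k' using 2
      omega
  · rintro i n ⟨b, b'⟩ ⟨c, c'⟩ hbc
    obtain ⟨h, h'⟩ := (PreCrystal.prod_e_eq_some_iff pairing C C' i n _ _).1 hbc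
    refine (PreCrystal.prod_e_eq_some_iff pairing C C' i (-n) _ _).2 ?_
    have hεc := hε _ _ _ _ h
    have hφc := hφ' h'
    dsimp only at *
    constructor
    · convert hinv i _ _ _ h using 2
      omega
    · convert hinv' i _ _ _ h' using 2
      omega
  · rintro i n m ⟨b, b'⟩ hn hm₁ hm₂
    obtain ⟨h, h'⟩ := (PreCrystal.isSome_prod_e_iff pairing C C' i n _).1 hn
    refine (PreCrystal.isSome_prod_e_iff pairing C C' i m _).2 ⟨?_, ?_⟩
    · refine hint i _ _ _ h ?_ ?_ <;> dsimp only <;> omega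
    · refine hint' i _ _ _ h' ?_ ?_ <;> dsimp only <;> omega
  · rintro i n ⟨b, b'⟩ ⟨c, c'⟩ hbc
    obtain ⟨h, h'⟩ := (PreCrystal.prod_e_eq_some_iff pairing C C' i n _ _).1 hbc
    have h₁ := hγ _ _ _ _ h
    have h₂ := hγ' _ _ _ _ h'
    simp only [PreCrystal.prod] at *
    rw [h₁, h₂, add_add_add_comm, ← add_smul]
    congr 2
    omega
  · rintro i n ⟨b, b'⟩ ⟨c, c'⟩ hbc
    obtain ⟨h, h'⟩ := (PreCrystal.prod_e_eq_some_iff pairing C C' i n _ _).1 hbc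
    have h₁ := hε _ _ _ _ h
    have h₂ := hε' _ _ _ _ h'
    have h₃ := hφ' h'
    have h₄ := hwt' i b'
    have h₅ := hwt' i c'
    simp only [PreCrystal.prod] at *
    omega

theorem UpperNormal.ε_nonneg {αv : I → Λ} {pairing : I → Λ →+ ℤ} {C : PreCrystal I Λ}
    (hC : IsCrystal αv pairing C) (h : UpperNormal C) (i : I) (b : C.B) : 0 ≤ C.ε i b :=
  (h i b).2 0 (by rw [hC.2.1 i b]; rfl)

theorem LowerNormal.φ_nonneg {αv : I → Λ} {pairing : I → Λ →+ ℤ} {C : PreCrystal I Λ}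
    (hC : IsCrystal αv pairing C) (h : LowerNormal C) (i : I) (b : C.B) : 0 ≤ C.φ i b :=
  neg_nonpos.1 ((h i b).2 0 (by rw [hC.2.1 i b]; rfl))

theorem UpperNormal.prod {αv : I → Λ} {pairing : I → Λ →+ ℤ} {C C' : PreCrystal I Λ}
    (hC : IsCrystal αv pairing C) (hC' : IsCrystal αv pairing C')
    (h : UpperNormal C) (h' : NormalCrystal C') : UpperNormal (C.prod pairing C') := by
  rintro i ⟨b, b'⟩
  have hε := h.ε_nonneg hC i b
  have hε' := h'.1.ε_nonneg hC' i b'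
  have hφ' := h'.2.φ_nonneg hC' i b'
  have hwt' := hC'.1 i b'
  constructor
  · refine (PreCrystal.isSome_prod_e_iff pairing C C' i _ _).2 ⟨?_, ?_⟩
    · refine hC.2.2.2.2.1 i _ _ _ (h i b).1 ?_ ?_ <;> simp only [PreCrystal.prod] <;> omega
    · refine hC'.2.2.2.2.1 i _ _ _ (h'.1 i b').1 ?_ ?_ <;> simp only [PreCrystal.prod] <;> omega
  · intro n hn
    obtain ⟨-, k'⟩ := (PreCrystal.isSome_prod_e_iff pairing C C' i n _).1 hn
    have := (h'.1 i b').2 _ k'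
    simp only [PreCrystal.prod] at *
    omega

theorem LowerNormal.prod {αv : I → Λ} {pairing : I → Λ →+ ℤ} {C C' : PreCrystal I Λ}
    (hC : IsCrystal αv pairing C) (hC' : IsCrystal αv pairing C')
    (h : NormalCrystal C) (h' : LowerNormal C') : LowerNormal (C.prod pairing C') := by
  rintro i ⟨b, b'⟩
  have hε := h.1.ε_nonneg hC i b
  have hφ := h.2.φ_nonneg hC i b
  have hφ' := h'.φ_nonneg hC' i b'
  have hwt := hC.1 i b
  constructor
  · refine (PreCrystal.isSome_prod_e_iff pairing C C' i _ _).2 ⟨?_, ?_⟩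
    · refine hC.2.2.2.2.1 i _ _ _ (h.2 i b).1 ?_ ?_ <;> simp only [PreCrystal.prod] <;> omega
    · refine hC'.2.2.2.2.1 i _ _ _ (h' i b').1 ?_ ?_ <;> simp only [PreCrystal.prod] <;> omega
  · intro n hn
    obtain ⟨k, -⟩ := (PreCrystal.isSome_prod_e_iff pairing C C' i n _).1 hn
    have := (h.2 i b).2 _ k
    simp only [PreCrystal.prod] at *
    omega

/-- If `𝓑` is an upper normal crystal and `𝓑'` is a normal crystal, then `𝓑 × 𝓑'` is an
upper normal crystal; dually, if `𝓑` is lower normal and `𝓑'` is normal, then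
`𝓑' × 𝓑` is lower normal.  In particular, for all `(b, b')` and `i`, the quantity
`ℓᵢ(b,b') = sup{n ≥ 0 : ẽᵢⁿ(b,b') defined}` is finite and equals
`ε''ᵢ(b,b') = max(ε'ᵢ(b'), εᵢ(b) − αᵢ(γ'(b')))` (which is what upper normality of the
product asserts). -/
theorem prod_upper_normal_of_upper_normal {I : Type*} {Λ : Type*}
    [Nonempty I] [Finite I] [AddCommGroup Λ] [Module.Free ℤ Λ] [Module.Finite ℤ Λ]
    (αv : I → Λ) (pairing : I → Λ →+ ℤ) (hpair : ∀ i, pairing i (αv i) = 2) :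
    (∀ C C' : PreCrystal I Λ, IsCrystal αv pairing C → IsCrystal αv pairing C' →
      UpperNormal C → NormalCrystal C' →
        IsCrystal αv pairing (C.prod pairing C') ∧
        UpperNormal (C.prod pairing C') ∧
        ∀ i (b : C.B) (b' : C'.B),
          (C.prod pairing C').ε i (b, b') =
            max (C'.ε i b') (C.ε i b - pairing i (C'.wt b'))) ∧
    (∀ C C' : PreCrystal I Λ, IsCrystal αv pairing C → IsCrystal αv pairing C' →
      LowerNormal C → NormalCrystal C' →
        IsCrystal αv pairing (C'.prod pairing C) ∧
        LowerNormal (C'.prod pairing C)) := by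
  exact ⟨fun C C' hC hC' h h' => ⟨hC.prod hpair hC', h.prod hC hC' h', fun _ _ _ => rfl⟩,
    fun C C' hC hC' h h' => ⟨hC'.prod hpair hC, LowerNormal.prod hC' hC h' h⟩⟩
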